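/- Let f : ℝ × ℝ^N → ℝ satisfy Hypothesis 5. If for every K > 0 there exists K' ≥ K such that (f_{K'})** coincides with f** on ℝ × B_K(0), then f** is continuous in both variables on ℝ × ℝ^N. -/

import Mathlib

open MeasureTheory Filter Metric Set Topology
open scoped RealInnerProductSpace ENNReal NNReal

/-- Euclidean space `ℝ^N`. -/
abbrev Euc (N : ℕ) := EuclideanSpace ℝ (Fin N)

/-- A bounded open set with Lipschitz boundary (interior direction condition at the
boundary, a standard property of bounded Lipschitz domains). -/
def IsLipschitzDomain {N : ℕ} (Ω : Set (Euc N)) : Prop :=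
  IsOpen Ω ∧ Bornology.IsBounded Ω ∧
    ∀ x ∈ frontier Ω, ∃ v : Euc N, ‖v‖ = 1 ∧ ∃ r > (0 : ℝ), ∃ ε > (0 : ℝ),
      ∀ y ∈ ball x r ∩ closure Ω, ∀ t ∈ Set.Ioo (0 : ℝ) ε, y + t • v ∈ Ω

/-- `u ∈ W^{1,∞}(Ω)`: `u` is (a representative of) a Lipschitz function on `Ω`
(equivalently, on its closure). -/
def MemW1inf {N : ℕ} (Ω : Set (Euc N)) (u : Euc N → ℝ) : Prop :=
  ∃ C : ℝ≥0, LipschitzOnWith C u (closure Ω)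

/-- `‖∇u‖_{L^∞(Ω)} < K`: the essential supremum of `‖∇u‖` on `Ω` is `< K`. -/
def GradSupLt {N : ℕ} (Ω : Set (Euc N)) (u : Euc N → ℝ) (K : ℝ) : Prop :=
  ∃ C : ℝ, C < K ∧ ∀ᵐ x ∂(volume.restrict Ω), ‖gradient u x‖ ≤ C

/-- Weak* convergence `v_n ⇀* u` in `W^{1,∞}(Ω)`: uniform convergence of the functions on
`Ω` together with weak* convergence of the gradients in `L^∞(Ω; ℝ^N)` (testing against
arbitrary `L¹` vector fields). -/
def WeakStarConvW1inf {N : ℕ} (Ω : Set (Euc N)) (v : ℕ → Euc N → ℝ) (u : Euc N → ℝ) : Prop :=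
  TendstoUniformlyOn v u atTop Ω ∧
    ∀ G : Euc N → Euc N, Integrable G (volume.restrict Ω) →
      Tendsto (fun n => ∫ x in Ω, ⟪gradient (v n) x, G x⟫) atTop
        (𝓝 (∫ x in Ω, ⟪gradient u x, G x⟫))

/-- The bipolar `g**` of a function `g` (restricted to the set `s`, i.e. `g = +∞` off `s`)
with respect to the variable `ξ`: the pointwise supremum of all affine minorants of `g` on
`s`, which is the largest convex lower semicontinuous function below `g` on `s`. -/
noncomputable def convexifyOn {N : ℕ} (g : Euc N → ℝ) (s : Set (Euc N)) (ξ : Euc N) : ℝ :=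
  sSup { r : ℝ | ∃ p : Euc N, ∃ c : ℝ, (∀ ζ ∈ s, ⟪p, ζ⟫ + c ≤ g ζ) ∧ r = ⟪p, ξ⟫ + c }


/-- Hypothesis 5 for an autonomous Lagrangian `f : ℝ × ℝ^N → ℝ`:
(i) `f` is Borel;
(ii) `f(u,ξ)` is continuous in `u` uniformly as `ξ` varies in each bounded set of `ℝ^N`;
(iii) `f(u,·)` is bounded on bounded sets of `ℝ^N` for every `u`. -/
def Hyp5 {N : ℕ} (f : ℝ → Euc N → ℝ) : Prop :=
  Measurable (fun q : ℝ × Euc N => f q.1 q.2) ∧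
  (∀ u₀ : ℝ, ∀ B : Set (Euc N), Bornology.IsBounded B → ∀ ε > (0 : ℝ), ∃ δ > (0 : ℝ),
      ∀ u : ℝ, |u - u₀| < δ → ∀ ξ ∈ B, |f u ξ - f u₀ ξ| < ε) ∧
  (∀ u : ℝ, ∀ B : Set (Euc N), Bornology.IsBounded B → ∃ M : ℝ, ∀ ξ ∈ B, |f u ξ| ≤ M)

/-- The bipolar `g**` with values in the extended reals, of a real-valued function `g`
truncated to `+∞` off the set `s`: the pointwise supremum of all affine minorants of `g`
on `s` (i.e. the biconjugate of the truncated function in the variable `ξ`). -/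
noncomputable def convexifyOnE {N : ℕ} (g : Euc N → ℝ) (s : Set (Euc N)) (ξ : Euc N) :
    EReal :=
  ⨆ (p : Euc N) (c : ℝ) (_ : ∀ ζ ∈ s, ⟪p, ζ⟫ + c ≤ g ζ), ((⟪p, ξ⟫ + c : ℝ) : EReal)

/-- The values at `ξ` of the affine minorants of `g` on `s` are bounded above by `g ξ`. -/
lemma bddAbove_affineMinorants {N : ℕ} (g : Euc N → ℝ) {s : Set (Euc N)} {ξ : Euc N}
    (hξ : ξ ∈ s) :
    BddAbove { r : ℝ | ∃ p : Euc N, ∃ c : ℝ,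
      (∀ ζ ∈ s, ⟪p, ζ⟫ + c ≤ g ζ) ∧ r = ⟪p, ξ⟫ + c } := by
  refine ⟨g ξ, ?_⟩
  rintro r ⟨p, c, hpc, rfl⟩
  exact hpc ξ hξ

/-- A function bounded below on `s` has an affine minorant there. -/
lemma nonempty_affineMinorants {N : ℕ} {g : Euc N → ℝ} {s : Set (Euc N)} {m : ℝ}
    (hm : ∀ ζ ∈ s, m ≤ g ζ) (ξ : Euc N) :
    { r : ℝ | ∃ p : Euc N, ∃ c : ℝ,
      (∀ ζ ∈ s, ⟪p, ζ⟫ + c ≤ g ζ) ∧ r = ⟪p, ξ⟫ + c }.Nonempty :=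
  ⟨m, 0, m, fun ζ hζ => by simpa using hm ζ hζ, by simp⟩

lemma le_convexifyOn {N : ℕ} {g : Euc N → ℝ} {s : Set (Euc N)} {ξ p : Euc N} {c : ℝ}
    (hξ : ξ ∈ s) (hpc : ∀ ζ ∈ s, ⟪p, ζ⟫ + c ≤ g ζ) :
    ⟪p, ξ⟫ + c ≤ convexifyOn g s ξ :=
  le_csSup (bddAbove_affineMinorants g hξ) ⟨p, c, hpc, rfl⟩

lemma convexifyOn_le {N : ℕ} {g : Euc N → ℝ} {s : Set (Euc N)} {ξ : Euc N} {m r : ℝ}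
    (hm : ∀ ζ ∈ s, m ≤ g ζ)
    (hr : ∀ (p : Euc N) (c : ℝ), (∀ ζ ∈ s, ⟪p, ζ⟫ + c ≤ g ζ) → ⟪p, ξ⟫ + c ≤ r) :
    convexifyOn g s ξ ≤ r := by
  refine csSup_le (nonempty_affineMinorants hm ξ) ?_
  rintro _ ⟨p, c, hpc, rfl⟩
  exact hr p c hpc

/-- On `s`, the extended-real bipolar of a function bounded below on `s` is finite. -/
lemma convexifyOnE_eq_coe {N : ℕ} {g : Euc N → ℝ} {s : Set (Euc N)} {ξ : Euc N} {m : ℝ}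
    (hξ : ξ ∈ s) (hm : ∀ ζ ∈ s, m ≤ g ζ) :
    convexifyOnE g s ξ = (convexifyOn g s ξ : EReal) := by
  apply le_antisymm
  · exact iSup_le fun p => iSup_le fun c => iSup_le fun hpc =>
      EReal.coe_le_coe_iff.2 (le_convexifyOn hξ hpc)
  · have hle : ∀ (p : Euc N) (c : ℝ), (∀ ζ ∈ s, ⟪p, ζ⟫ + c ≤ g ζ) →
        ((⟪p, ξ⟫ + c : ℝ) : EReal) ≤ convexifyOnE g s ξ := fun p c hpc =>
      le_iSup_of_le p (le_iSup_of_le c (le_iSup_of_le hpc le_rfl))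
    refine EReal.le_of_forall_lt_iff_le.1 fun r hr => ?_
    exact EReal.coe_le_coe_iff.2 (convexifyOn_le hm fun p c hpc =>
      EReal.coe_le_coe_iff.1 ((hle p c hpc).trans hr.le))

lemma convexOn_convexifyOn {N : ℕ} {g : Euc N → ℝ} {s : Set (Euc N)} {m : ℝ}
    (hs : Convex ℝ s) (hm : ∀ ζ ∈ s, m ≤ g ζ) : ConvexOn ℝ s (convexifyOn g s) := by
  refine ⟨hs, fun x hx y hy a b ha hb hab => convexifyOn_le hm fun p c hpc => ?_⟩
  calc ⟪p, a • x + b • y⟫ + c = a • (⟪p, x⟫ + c) + b • (⟪p, y⟫ + c) := by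
        simp only [inner_add_right, inner_smul_right, smul_eq_mul]
        linear_combination (-c) * hab
    _ ≤ a • convexifyOn g s x + b • convexifyOn g s y := by
        gcongr
        · exact le_convexifyOn hx hpc
        · exact le_convexifyOn hy hpc

lemma convexifyOn_le_add {N : ℕ} {g g' : Euc N → ℝ} {s : Set (Euc N)} {ξ : Euc N} {m ε : ℝ}
    (hξ : ξ ∈ s) (hm : ∀ ζ ∈ s, m ≤ g ζ) (hgg' : ∀ ζ ∈ s, g ζ ≤ g' ζ + ε) :
    convexifyOn g s ξ ≤ convexifyOn g' s ξ + ε := by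
  refine convexifyOn_le hm fun p c hpc => ?_
  have := le_convexifyOn (g := g') (p := p) (c := c - ε) hξ fun ζ hζ => by
    linarith [hpc ζ hζ, hgg' ζ hζ]
  linarith

/-- The bipolar is nonexpansive for the uniform distance on `s`. -/
lemma abs_convexifyOn_sub_le {N : ℕ} {g g' : Euc N → ℝ} {s : Set (Euc N)} {ξ : Euc N}
    {m m' ε : ℝ} (hξ : ξ ∈ s) (hm : ∀ ζ ∈ s, m ≤ g ζ) (hm' : ∀ ζ ∈ s, m' ≤ g' ζ)
    (hgg' : ∀ ζ ∈ s, |g ζ - g' ζ| ≤ ε) :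
    |convexifyOn g s ξ - convexifyOn g' s ξ| ≤ ε := by
  have h₁ := convexifyOn_le_add (g' := g') (ε := ε) hξ hm fun ζ hζ => by
    linarith [(abs_le.1 (hgg' ζ hζ)).2]
  have h₂ := convexifyOn_le_add (g' := g) (ε := ε) hξ hm' fun ζ hζ => by
    linarith [(abs_le.1 (hgg' ζ hζ)).1]
  exact abs_le.2 ⟨by linarith, by linarith⟩

lemma Hyp5.exists_lowerBound {N : ℕ} {f : ℝ → Euc N → ℝ} (hf : Hyp5 f) {B : Set (Euc N)}
    (hB : Bornology.IsBounded B) (u : ℝ) : ∃ m : ℝ, ∀ ζ ∈ B, m ≤ f u ζ := by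
  obtain ⟨M, hM⟩ := hf.2.2 u B hB
  exact ⟨-M, fun ζ hζ => (abs_le.1 (hM ζ hζ)).1⟩

/-- The bipolar of the truncation of `f` to a bounded convex set is jointly continuous at the
points over the interior of that set. -/
lemma Hyp5.continuousAt_convexifyOn {N : ℕ} {f : ℝ → Euc N → ℝ} (hf : Hyp5 f)
    {s : Set (Euc N)} (hs : Convex ℝ s) (hsb : Bornology.IsBounded s) (u₀ : ℝ) {ξ₀ : Euc N}
    (hξ₀ : ξ₀ ∈ interior s) :
    ContinuousAt (fun q : ℝ × Euc N => convexifyOn (f q.1) s q.2) (u₀, ξ₀) := by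
  choose m hm using hf.exists_lowerBound hsb
  have hcont : ContinuousAt (convexifyOn (f u₀) s) ξ₀ :=
    (convexOn_convexifyOn hs (hm u₀)).continuousOn_interior.continuousAt
      (isOpen_interior.mem_nhds hξ₀)
  rw [Metric.continuousAt_iff'] at hcont ⊢
  intro ε hε
  obtain ⟨δ, hδ, hfδ⟩ := hf.2.1 u₀ s hsb (ε / 2) (half_pos hε)
  have hu_near : ∀ᶠ q : ℝ × Euc N in 𝓝 (u₀, ξ₀), q.1 ∈ ball u₀ δ :=
    continuousAt_fst.eventually_mem (Metric.ball_mem_nhds u₀ hδ)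
  have hξ_near : ∀ᶠ q : ℝ × Euc N in 𝓝 (u₀, ξ₀), q.2 ∈ interior s :=
    continuousAt_snd.eventually_mem (isOpen_interior.mem_nhds hξ₀)
  filter_upwards [hu_near, hξ_near, continuousAt_snd.eventually (hcont (ε / 2) (half_pos hε))]
    with q hu hq hc
  have hdist : dist (convexifyOn (f q.1) s q.2) (convexifyOn (f u₀) s q.2) ≤ ε / 2 :=
    abs_convexifyOn_sub_le (interior_subset hq) (hm q.1) (hm u₀)
      fun ζ hζ => (hfδ q.1 (by simpa [Real.dist_eq] using hu) ζ hζ).le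
  linarith [dist_triangle (convexifyOn (f q.1) s q.2) (convexifyOn (f u₀) s q.2)
    (convexifyOn (f u₀) s ξ₀)]

/-- Corollary 5.8: under Hypothesis 5, if for every `K > 0` there is
`K' ≥ K` such that the bipolar `(f_{K'})**` of the truncation of `f` at radius `K'`
coincides with `f**` on `ℝ × B_K(0)`, then `f**` is continuous in both variables. -/
theorem bipolar_continuous_of_truncations_agree
    {N : ℕ} (f : ℝ → Euc N → ℝ) (hf : Hyp5 f)
    (h : ∀ K : ℝ, 0 < K → ∃ K' : ℝ, K ≤ K' ∧ ∀ u : ℝ, ∀ ξ ∈ ball (0 : Euc N) K,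
      convexifyOnE (f u) (closedBall (0 : Euc N) K') ξ = convexifyOnE (f u) Set.univ ξ) :
    Continuous fun q : ℝ × Euc N => convexifyOnE (f q.1) Set.univ q.2 := by
  refine continuous_iff_continuousAt.2 fun ⟨u₀, ξ₀⟩ => ?_
  obtain ⟨K', hK', heq⟩ := h (‖ξ₀‖ + 1) (by positivity)
  have hball : ball (0 : Euc N) (‖ξ₀‖ + 1) ⊆ closedBall 0 K' :=
    (ball_subset_ball hK').trans ball_subset_closedBall
  have hξ₀ : ξ₀ ∈ ball (0 : Euc N) (‖ξ₀‖ + 1) := by simp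
  have hcont := hf.continuousAt_convexifyOn (convex_closedBall (0 : Euc N) K')
    isBounded_closedBall u₀ (interior_maximal hball isOpen_ball hξ₀)
  refine (continuous_coe_real_ereal.continuousAt.comp hcont).congr ?_
  have hnhds : ∀ᶠ q : ℝ × Euc N in 𝓝 (u₀, ξ₀), q.2 ∈ ball (0 : Euc N) (‖ξ₀‖ + 1) :=
    continuousAt_snd.eventually_mem (isOpen_ball.mem_nhds hξ₀)
  filter_upwards [hnhds] with q hq
  obtain ⟨m, hm⟩ := hf.exists_lowerBound (isBounded_closedBall (x := (0 : Euc N)) (r := K')) q.1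
  exact (convexifyOnE_eq_coe (hball hq) hm).symm.trans (heq q.1 q.2 hq)
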